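/- Let w > 0 and let k ≥ 2 be an integer such that r_{k−1} ≥ w², |θ̃_{k−1}| ≤ 1, and |y_{k−1}| ≤ w/(2√(k−1)). If w_t = −θ̃_{t−1}·y_{t−1} + S(y_{t−1})·w/(2√t) for all t ≥ k, then there exists an integer k' ≥ k such that the sequence (|θ̃_t|)_{t≥k'} is strictly increasing and lim_{t→∞} |θ̃_t| = +∞. -/

import Mathlib

open Filter Finset

/-- The sign function: `-1` if `x < 0`, `1` if `x ≥ 0`. -/
noncomputable def S (x : ℝ) : ℝ := if x < 0 then -1 else 1

lemma S_mul_self_eq_abs (x : ℝ) : S x * x = |x| := by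
  unfold S
  split_ifs with h
  · rw [abs_of_neg h]; ring
  · rw [abs_of_nonneg (not_lt.mp h)]; ring

lemma S_sq (x : ℝ) : S x ^ 2 = 1 := by
  unfold S
  split_ifs <;> norm_num

lemma abs_S (x : ℝ) : |S x| = 1 := by
  unfold S
  split_ifs <;> norm_num

lemma Real.log_sub_log_le_sub_div {a b : ℝ} (ha : 0 < a) (hb : 0 < b) :
    Real.log b - Real.log a ≤ (b - a) / a := by
  rw [← Real.log_div hb.ne' ha.ne', sub_div, div_self ha.ne']
  exact Real.log_le_sub_one_of_pos (div_pos hb ha)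

/-- A sequence with increments at least `c / (t + 1)` eventually, `c > 0`, tends to infinity. -/
lemma tendsto_atTop_of_harmonic_increments {r : ℕ → ℝ} {c : ℝ} (hc : 0 < c) {k : ℕ}
    (h : ∀ t, k ≤ t → c / ((t : ℝ) + 1) ≤ r (t + 1) - r t) : Tendsto r atTop atTop := by
  have hbound : ∀ t, k ≤ t →
      (r k - c * Real.log ((k : ℝ) + 1)) + c * Real.log ((t : ℝ) + 1) ≤ r t := by
    intro t ht
    induction t, ht using Nat.le_induction with
    | base => linarith
    | succ t ht ih =>
      have hlog := Real.log_sub_log_le_sub_div (a := (t : ℝ) + 1) (b := (t : ℝ) + 1 + 1)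
        (by positivity) (by positivity)
      have hmul := mul_le_mul_of_nonneg_left hlog hc.le
      have heq : c * (((t : ℝ) + 1 + 1 - (t + 1)) / (t + 1)) = c / ((t : ℝ) + 1) := by ring
      have hstep := h t ht
      push_cast
      linarith
  refine tendsto_atTop_mono' atTop ((eventually_ge_atTop k).mono hbound) ?_
  refine tendsto_atTop_add_const_left _ _ (Tendsto.const_mul_atTop hc ?_)
  exact Real.tendsto_log_atTop.comp
    (tendsto_atTop_add_const_right _ _ tendsto_natCast_atTop_atTop)

/-- Lemma 2: with the constructed noise, there is `k' ≥ k` such that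
`(|θ̃ t|)_{t ≥ k'}` is strictly increasing and `|θ̃ t| → +∞`. -/
theorem estimate_error_diverges
    (y θ r W : ℕ → ℝ) (hr0 : 0 < r 0)
    (hy : ∀ t : ℕ, y (t + 1) = θ t * y t + W (t + 1))
    (hθ : ∀ t : ℕ, θ (t + 1) = θ t - y t * y (t + 1) / r t)
    (hr : ∀ t : ℕ, r (t + 1) = r t + (y (t + 1)) ^ 2)
    (w : ℝ) (hw : 0 < w) (k : ℕ) (hk : 2 ≤ k)
    (hrk : w ^ 2 ≤ r (k - 1))
    (hθk : |θ (k - 1)| ≤ 1)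
    (hyk : |y (k - 1)| ≤ w / (2 * Real.sqrt (k - 1 : ℕ)))
    (hW : ∀ t : ℕ, k ≤ t →
      W t = -θ (t - 1) * y (t - 1) + S (y (t - 1)) * w / (2 * Real.sqrt t)) :
    ∃ k' : ℕ, k ≤ k' ∧
      StrictMonoOn (fun t : ℕ => |θ t|) (Set.Ici k') ∧
      Tendsto (fun t : ℕ => |θ t|) atTop atTop := by
  have hrpos : ∀ t, 0 < r t := by
    intro t
    induction t with
    | zero => exact hr0
    | succ t ih => rw [hr]; positivity
  have hysucc : ∀ t, k ≤ t + 1 → y (t + 1) = S (y t) * (w / (2 * √((t : ℝ) + 1))) := by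
    intro t ht
    have h := hW (t + 1) ht
    rw [Nat.add_sub_cancel] at h
    rw [hy, h]
    push_cast
    ring
  have hyabs : ∀ t, k ≤ t → |y t| = w / (2 * √(t : ℝ)) := by
    intro t ht
    obtain ⟨s, rfl⟩ : ∃ s, t = s + 1 := ⟨t - 1, by omega⟩
    rw [hysucc s ht, abs_mul, abs_S, one_mul, abs_of_nonneg (by positivity)]
    push_cast
    rfl
  have hysq : ∀ t, k ≤ t → y (t + 1) ^ 2 = w ^ 2 / 4 / ((t : ℝ) + 1) := by
    intro t ht
    rw [hysucc t (by omega), mul_pow, S_sq, div_pow, mul_pow, Real.sq_sqrt (by positivity)]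
    field_simp
    norm_num
  have hprod : ∀ t, k ≤ t → y (t + 1) ^ 2 ≤ y t * y (t + 1) := by
    intro t ht
    have ht0 : (0 : ℝ) < t := by exact_mod_cast (by omega : 0 < t)
    have h1 : y t * y (t + 1) = |y t| * (w / (2 * √((t : ℝ) + 1))) := by
      rw [hysucc t (by omega), ← S_mul_self_eq_abs]; ring
    have h2 : y (t + 1) ^ 2 = (w / (2 * √((t : ℝ) + 1))) * (w / (2 * √((t : ℝ) + 1))) := by
      rw [hysucc t (by omega), mul_pow, S_sq]; ring
    rw [h1, h2, hyabs t ht]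
    gcongr
    linarith
  have hsqpos : ∀ t, k ≤ t → 0 < y (t + 1) ^ 2 := by
    intro t ht
    rw [hysq t ht]
    positivity
  have hrtop : Tendsto r atTop atTop :=
    tendsto_atTop_of_harmonic_increments (c := w ^ 2 / 4) (by positivity) (k := k)
      fun t ht => by rw [hr, hysq t ht]; linarith
  have hθlog : ∀ t, k ≤ t → Real.log (r t) - (θ k + Real.log (r k)) ≤ -θ t := by
    intro t ht
    induction t, ht using Nat.le_induction with
    | base => linarith
    | succ t ht ih =>
      have hlog := Real.log_sub_log_le_sub_div (hrpos t) (hrpos (t + 1))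
      have hle : (r (t + 1) - r t) / r t ≤ y t * y (t + 1) / r t := by
        have := hprod t ht
        have := hrpos t
        gcongr
        rw [hr]
        linarith
      rw [hθ]
      linarith
  have hneg : Tendsto (fun t => -θ t) atTop atTop := by
    refine tendsto_atTop_mono' atTop ((eventually_ge_atTop k).mono hθlog) ?_
    exact tendsto_atTop_add_const_right _ _ (Real.tendsto_log_atTop.comp hrtop)
  obtain ⟨N, hN⟩ := eventually_atTop.mp (hneg.eventually_ge_atTop 0)
  refine ⟨max k N, le_max_left _ _, ?_,
    tendsto_atTop_mono (fun t => neg_le_abs (θ t)) hneg⟩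
  refine strictMonoOn_of_lt_add_one Set.ordConnected_Ici fun t _ ht _ => ?_
  have htk : k ≤ t := (le_max_left _ _).trans ht
  have htN : N ≤ t := (le_max_right _ _).trans ht
  have h1 : θ t ≤ 0 := by linarith [hN t htN]
  have h2 : θ (t + 1) ≤ 0 := by linarith [hN (t + 1) (by omega)]
  have h3 : 0 < y t * y (t + 1) / r t :=
    div_pos ((hsqpos t htk).trans_le (hprod t htk)) (hrpos t)
  simp only [abs_of_nonpos h1, abs_of_nonpos h2]
  linarith [hθ t]
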